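/- arXiv:2410.14190 — 3 statements merged into one kernel-verified Lean document; each statement's English description precedes it below -/
import Mathlib

section
/- For |q|<1, (q^2;q^2)_∞ · (-q;q^2)_∞^2 = ∑_{n=-∞}^{∞} q^{n^2} = 1 + 2∑_{n≥1} q^{n^2}. -/
open scoped BigOperators

noncomputable def qPoch (a q : ℂ) (n : ℕ) : ℂ := ∏ j ∈ Finset.range n, (1 - a * q ^ j)

noncomputable def qPochInf (a q : ℂ) : ℂ := ∏' j : ℕ, (1 - a * q ^ j)

open Filter Topology

/-- Gaussian binomial coefficients. -/
noncomputable def gb (Q : ℂ) : ℕ → ℕ → ℂ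
  | _, 0 => 1
  | 0, _ + 1 => 0
  | n + 1, k + 1 => gb Q n k + Q ^ (k + 1) * gb Q n (k + 1)

lemma gb_zero_right (Q : ℂ) (n : ℕ) : gb Q n 0 = 1 := by cases n <;> simp [gb]

lemma gb_succ (Q : ℂ) (n k : ℕ) :
    gb Q (n + 1) (k + 1) = gb Q n k + Q ^ (k + 1) * gb Q n (k + 1) := by simp [gb]

lemma gb_eq_zero (Q : ℂ) (n : ℕ) : ∀ k, n < k → gb Q n k = 0 := by
  induction n with
  | zero => intro k hk; obtain ⟨k, rfl⟩ := Nat.exists_eq_succ_of_ne_zero hk.ne'; simp [gb]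
  | succ n ih =>
    intro k hk
    obtain ⟨k, rfl⟩ := Nat.exists_eq_succ_of_ne_zero (by omega : k ≠ 0)
    rw [Nat.succ_eq_add_one, gb_succ, ih k (by omega), ih (k + 1) (by omega)]; simp

lemma gb_self (Q : ℂ) (n : ℕ) : gb Q n n = 1 := by
  induction n with
  | zero => simp [gb]
  | succ n ih => rw [gb_succ, ih, gb_eq_zero Q n (n + 1) (by omega)]; simp

lemma qPoch_succ (Q : ℂ) (n : ℕ) : qPoch Q Q (n + 1) = qPoch Q Q n * (1 - Q ^ (n + 1)) := by
  rw [qPoch, Finset.prod_range_succ, ← qPoch]; ring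

lemma gb_mul (Q : ℂ) (s : ℕ) : ∀ a b, a + b = s →
    gb Q (a + b) a * (qPoch Q Q a * qPoch Q Q b) = qPoch Q Q (a + b) := by
  induction s with
  | zero =>
    intro a b h
    obtain rfl : a = 0 := by omega
    obtain rfl : b = 0 := by omega
    simp [gb, qPoch]
  | succ s ih =>
    intro a b h
    rcases a with _ | a
    · simp [gb_zero_right, qPoch]
    rcases b with _ | b
    · simp [gb_self, qPoch]
    have h1 := ih a (b + 1) (by omega)
    have h2 := ih (a + 1) b (by omega)
    rw [show a + 1 + b = a + (b + 1) by ring] at h2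
    rw [show a + 1 + (b + 1) = (a + (b + 1)) + 1 by ring, gb_succ, qPoch_succ Q (a + (b + 1))]
    have ea := qPoch_succ Q a
    have eb := qPoch_succ Q b
    calc _ = (1 - Q ^ (a + 1)) * (gb Q (a + (b + 1)) a * (qPoch Q Q a * qPoch Q Q (b + 1)))
          + Q ^ (a + 1) * (1 - Q ^ (b + 1)) *
            (gb Q (a + (b + 1)) (a + 1) * (qPoch Q Q (a + 1) * qPoch Q Q b)) := by
            rw [ea, eb]; ring
      _ = _ := by rw [h1, h2]; ring

lemma q_binomial (q y : ℂ) (N : ℕ) : ∀ x : ℂ,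
    ∏ j ∈ Finset.range N, (y + x * q ^ (2 * j + 1)) =
      ∑ k ∈ Finset.range (N + 1), gb (q ^ 2) N k * q ^ (k ^ 2) * x ^ k * y ^ (N - k) := by
  induction N with
  | zero => intro x; simp [gb]
  | succ N ih =>
    intro x
    rw [Finset.prod_range_succ']
    have h1 : ∏ j ∈ Finset.range N, (y + x * q ^ (2 * (j + 1) + 1)) =
        ∏ j ∈ Finset.range N, (y + (x * q ^ 2) * q ^ (2 * j + 1)) :=
      Finset.prod_congr rfl fun j _ => by ring
    rw [h1, ih, Finset.sum_range_succ' _ (N + 1)]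
    have h2 : ∑ k ∈ Finset.range (N + 1),
        gb (q ^ 2) N k * q ^ (k ^ 2) * (x * q ^ 2) ^ k * y ^ (N - k) * y =
        (∑ k ∈ Finset.range (N + 1), gb (q ^ 2) N (k + 1) * (q ^ 2) ^ (k + 1) *
          q ^ ((k + 1) ^ 2) * x ^ (k + 1) * y ^ (N - k)) + y ^ (N + 1) := by
      rw [Finset.sum_range_succ' _ N, Finset.sum_range_succ _ N,
        gb_eq_zero _ N (N + 1) (by omega)]
      simp only [gb_zero_right]
      have : ∀ k ∈ Finset.range N, gb (q ^ 2) N (k + 1) * q ^ ((k + 1) ^ 2) *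
          (x * q ^ 2) ^ (k + 1) * y ^ (N - (k + 1)) * y = gb (q ^ 2) N (k + 1) *
          (q ^ 2) ^ (k + 1) * q ^ ((k + 1) ^ 2) * x ^ (k + 1) * y ^ (N - k) := by
        intro k hk
        have : N - k = (N - (k + 1)) + 1 := by have := Finset.mem_range.1 hk; omega
        rw [this, mul_pow]; ring
      rw [Finset.sum_congr rfl this]
      simp; ring
    have h3 : ∑ k ∈ Finset.range (N + 1),
        gb (q ^ 2) N k * q ^ (k ^ 2) * (x * q ^ 2) ^ k * y ^ (N - k) * (x * q) =
        ∑ k ∈ Finset.range (N + 1), gb (q ^ 2) N k *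
          q ^ ((k + 1) ^ 2) * x ^ (k + 1) * y ^ (N - k) :=
      Finset.sum_congr rfl fun k _ => by rw [mul_pow]; ring
    have h4 : ∑ k ∈ Finset.range (N + 1), gb (q ^ 2) (N + 1) (k + 1) * q ^ ((k + 1) ^ 2) *
        x ^ (k + 1) * y ^ (N + 1 - (k + 1)) = (∑ k ∈ Finset.range (N + 1), gb (q ^ 2) N k *
          q ^ ((k + 1) ^ 2) * x ^ (k + 1) * y ^ (N - k)) +
        ∑ k ∈ Finset.range (N + 1), gb (q ^ 2) N (k + 1) * (q ^ 2) ^ (k + 1) *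
          q ^ ((k + 1) ^ 2) * x ^ (k + 1) * y ^ (N - k) := by
      rw [← Finset.sum_add_distrib]
      refine Finset.sum_congr rfl fun k _ => ?_
      rw [gb_succ, Nat.add_sub_add_right]; ring
    rw [h4, ← h3, mul_add, Finset.sum_mul, h2]
    simp only [mul_zero, zero_add, pow_one]
    rw [Finset.sum_mul]
    simp [gb_zero_right]; ring

lemma prod_half (q : ℂ) (n m : ℕ) :
    ∏ j ∈ Finset.range n, (q ^ (2 * n + m) + q ^ (2 * j + 1 + m)) =
      q ^ (n ^ 2 + m * n) * ∏ j ∈ Finset.range n, (1 + q ^ (2 * j + 1)) := by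
  rw [← Finset.prod_range_reflect]
  have : ∀ j ∈ Finset.range n, q ^ (2 * n + m) + q ^ (2 * (n - 1 - j) + 1 + m) =
      q ^ (2 * (n - 1 - j) + 1) * q ^ m * (1 + q ^ (2 * j + 1)) := by
    intro j hj
    have : 2 * n + m = 2 * (n - 1 - j) + 1 + m + (2 * j + 1) := by
      have := Finset.mem_range.1 hj; omega
    rw [this]; ring
  rw [Finset.prod_congr rfl this, Finset.prod_mul_distrib, Finset.prod_mul_distrib]
  congr 1
  rw [Finset.prod_range_reflect (fun j => q ^ (2 * j + 1)) n, Finset.prod_pow_eq_pow_sum,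
    Finset.prod_const, Finset.card_range, pow_add, pow_mul]
  congr 2
  clear this
  induction n with
  | zero => simp
  | succ n ih => rw [Finset.sum_range_succ, ih]; ring

lemma finite_gauss (q : ℂ) (hq0 : q ≠ 0) (n : ℕ) :
    (∏ j ∈ Finset.range n, (1 + q ^ (2 * j + 1))) ^ 2 =
      ∑ k ∈ Finset.range (2 * n + 1), gb (q ^ 2) (2 * n) k * q ^ (((k : ℤ) - n) ^ 2).toNat := by
  have h := q_binomial q (q ^ (2 * n)) (2 * n) 1
  have hl : ∏ j ∈ Finset.range (2 * n), (q ^ (2 * n) + 1 * q ^ (2 * j + 1)) =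
      q ^ (3 * n ^ 2) * (∏ j ∈ Finset.range n, (1 + q ^ (2 * j + 1))) ^ 2 := by
    rw [two_mul n, Finset.prod_range_add, ← two_mul]
    have h1 := prod_half q n 0
    have h2 : ∏ j ∈ Finset.range n, (q ^ (2 * n) + 1 * q ^ (2 * (n + j) + 1)) =
        q ^ (2 * n ^ 2) * ∏ j ∈ Finset.range n, (1 + q ^ (2 * j + 1)) := by
      rw [show q ^ (2 * n ^ 2) = ∏ j ∈ Finset.range n, q ^ (2 * n) by
        rw [Finset.prod_const, Finset.card_range]; ring, ← Finset.prod_mul_distrib]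
      exact Finset.prod_congr rfl fun j _ => by ring
    simp only [add_zero, zero_mul] at h1
    rw [h2]
    simp only [one_mul]
    rw [h1]; ring
  rw [hl] at h
  have hr : ∑ k ∈ Finset.range (2 * n + 1),
      gb (q ^ 2) (2 * n) k * q ^ (k ^ 2) * 1 ^ k * (q ^ (2 * n)) ^ (2 * n - k) =
      q ^ (3 * n ^ 2) * ∑ k ∈ Finset.range (2 * n + 1),
        gb (q ^ 2) (2 * n) k * q ^ (((k : ℤ) - n) ^ 2).toNat := by
    rw [Finset.mul_sum]
    refine Finset.sum_congr rfl fun k hk => ?_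
    have hk' : k ≤ 2 * n := by have := Finset.mem_range.1 hk; omega
    have e : k ^ 2 + 2 * n * (2 * n - k) = 3 * n ^ 2 + (((k : ℤ) - n) ^ 2).toNat := by
      zify [hk']
      rw [Int.toNat_of_nonneg (by positivity)]; ring
    rw [one_pow, mul_one, ← pow_mul, mul_assoc, ← pow_add, e, pow_add]; ring
  rw [hr] at h
  exact mul_left_cancel₀ (pow_ne_zero _ hq0) h

/-- summand of the finite identity, extended by zero to all integers. -/
noncomputable def fterm (q : ℂ) (n : ℕ) (k : ℤ) : ℂ :=
  if k ∈ Finset.Icc (-(n : ℤ)) n then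
    qPoch (q ^ 2) (q ^ 2) n * gb (q ^ 2) (2 * n) (n + k).toNat * q ^ (k ^ 2).toNat else 0

lemma tsum_fterm (q : ℂ) (hq0 : q ≠ 0) (n : ℕ) :
    ∑' k, fterm q n k = qPoch (q ^ 2) (q ^ 2) n *
      (∏ j ∈ Finset.range n, (1 + q ^ (2 * j + 1))) ^ 2 := by
  rw [finite_gauss q hq0, tsum_eq_sum (s := Finset.Icc (-(n : ℤ)) n)
    (fun k hk => by simp only [fterm]; rw [if_neg hk]), Finset.mul_sum]
  symm
  refine Finset.sum_bij (fun k _ => (k : ℤ) - n) ?_ ?_ ?_ ?_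
  · intro k hk
    simp only [Finset.mem_range, Finset.mem_Icc] at *; omega
  · intro a _ b _ h; simpa using h
  · intro b hb
    simp only [Finset.mem_Icc] at hb
    exact ⟨(n + b).toNat, by simp only [Finset.mem_range]; omega, by omega⟩
  · intro k hk
    rw [fterm, if_pos (by simp only [Finset.mem_range, Finset.mem_Icc] at *; omega)]
    rw [show ((n : ℤ) + ((k : ℤ) - n)).toNat = k by omega]; ring

lemma fterm_eq (q : ℂ) (hP : ∀ n, qPoch (q ^ 2) (q ^ 2) n ≠ 0) (n : ℕ) (k : ℤ)
    (hk : k ∈ Finset.Icc (-(n : ℤ)) n) :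
    fterm q n k = qPoch (q ^ 2) (q ^ 2) n * qPoch (q ^ 2) (q ^ 2) (2 * n) *
      (qPoch (q ^ 2) (q ^ 2) (n + k).toNat)⁻¹ * (qPoch (q ^ 2) (q ^ 2) (n - k).toNat)⁻¹ *
      q ^ (k ^ 2).toNat := by
  rw [fterm, if_pos hk]
  simp only [Finset.mem_Icc] at hk
  have h := gb_mul (q ^ 2) _ (n + k).toNat (n - k).toNat rfl
  rw [show (n + k).toNat + (n - k).toNat = 2 * n by omega] at h
  rw [← h]
  have h1 := hP (n + k).toNat
  have h2 := hP (n - k).toNat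
  field_simp

lemma one_sub_ne (Q : ℂ) (hQ : ‖Q‖ < 1) (j : ℕ) : 1 + -(Q * Q ^ j) ≠ 0 := by
  intro h
  have h1 : Q ^ (j + 1) = 1 := by rw [pow_succ']; linear_combination -h
  have h2 : ‖Q‖ ^ (j + 1) = 1 := by rw [← norm_pow, h1, norm_one]
  have := pow_lt_one₀ (norm_nonneg Q) hQ (Nat.succ_ne_zero j)
  simp only [Nat.succ_eq_add_one] at this
  linarith

lemma summable_aux (a Q : ℂ) (hQ : ‖Q‖ < 1) : Summable fun j : ℕ => ‖-(a * Q ^ j)‖ := by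
  simp only [norm_neg, norm_mul, norm_pow]
  exact (summable_geometric_of_lt_one (norm_nonneg _) hQ).mul_left _

lemma tendsto_qPoch (a Q : ℂ) (hQ : ‖Q‖ < 1) :
    Tendsto (fun n => qPoch a Q n) atTop (𝓝 (qPochInf a Q)) := by
  have := (multipliable_one_add_of_summable (summable_aux a Q hQ)).tendsto_prod_tprod_nat
  simpa only [← sub_eq_add_neg, qPoch, qPochInf] using this

lemma qPochInf_ne (Q : ℂ) (hQ : ‖Q‖ < 1) : qPochInf Q Q ≠ 0 := by
  have := tprod_one_add_ne_zero_of_summable (one_sub_ne Q hQ) (summable_aux Q Q hQ)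
  simpa only [← sub_eq_add_neg, qPoch, qPochInf] using this

lemma qPoch_ne (Q : ℂ) (hQ : ‖Q‖ < 1) (n : ℕ) : qPoch Q Q n ≠ 0 :=
  Finset.prod_ne_zero_iff.2 fun j _ => by
    have := one_sub_ne Q hQ j
    rwa [← sub_eq_add_neg] at this

lemma summable_sq_nat (r : ℝ) (h0 : 0 ≤ r) (h1 : r < 1) : Summable fun n : ℕ => r ^ (n ^ 2) := by
  refine (summable_geometric_of_lt_one h0 h1).of_nonneg_of_le (fun n => by positivity) fun n => ?_
  exact pow_le_pow_of_le_one h0 h1.le (Nat.le_self_pow (by norm_num) n)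

lemma summable_sq_int (r : ℝ) (h0 : 0 ≤ r) (h1 : r < 1) :
    Summable fun n : ℤ => r ^ (n ^ 2).toNat := by
  have h := summable_sq_nat r h0 h1
  have e : ∀ n : ℕ, ((n : ℤ) ^ 2).toNat = n ^ 2 := fun n => by
    rw [← Nat.cast_pow, Int.toNat_natCast]
  refine Summable.of_nat_of_neg ?_ ?_
  · simpa only [e] using h
  · simpa only [neg_sq, e] using h

lemma bounded_of_tendsto (u : ℕ → ℂ) (x : ℂ) (h : Tendsto u atTop (𝓝 x)) :
    ∃ C, 0 ≤ C ∧ ∀ n, ‖u n‖ ≤ C := by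
  obtain ⟨C, hC⟩ := (Metric.isBounded_range_of_tendsto u h).exists_norm_le
  exact ⟨C, (norm_nonneg _).trans (hC (u 0) ⟨0, rfl⟩), fun n => hC _ ⟨n, rfl⟩⟩

lemma main_ne (q : ℂ) (hq : ‖q‖ < 1) (hq0 : q ≠ 0) :
    qPochInf (q ^ 2) (q ^ 2) * (qPochInf (-q) (q ^ 2)) ^ 2 = ∑' n : ℤ, q ^ (n ^ 2).toNat := by
  have hQ : ‖q ^ 2‖ < 1 := by
    rw [norm_pow]; exact pow_lt_one₀ (norm_nonneg _) hq two_ne_zero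
  have hP := qPoch_ne _ hQ
  have hL := qPochInf_ne _ hQ
  have hT := tendsto_qPoch (q ^ 2) _ hQ
  have hTi := hT.inv₀ hL
  obtain ⟨C, hC0, hC⟩ := bounded_of_tendsto _ _ hT
  obtain ⟨D, hD0, hD⟩ := bounded_of_tendsto _ _ hTi
  have lim1 : Tendsto (fun n => ∑' k, fterm q n k) atTop
      (𝓝 (qPochInf (q ^ 2) (q ^ 2) * (qPochInf (-q) (q ^ 2)) ^ 2)) := by
    simp only [tsum_fterm q hq0]
    refine hT.mul (Tendsto.pow ?_ 2)
    refine (tendsto_qPoch (-q) _ hQ).congr fun n => ?_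
    exact Finset.prod_congr rfl fun j _ => by ring
  refine tendsto_nhds_unique lim1 ?_
  refine tendsto_tsum_of_dominated_convergence
    (bound := fun k : ℤ => C * C * D * D * ‖q‖ ^ (k ^ 2).toNat)
    ((summable_sq_int _ (norm_nonneg _) hq).mul_left _) ?_ ?_
  · intro k
    have ev : ∀ᶠ n : ℕ in atTop, k ∈ Finset.Icc (-(n : ℤ)) n := by
      filter_upwards [eventually_ge_atTop k.natAbs] with n hn
      simp only [Finset.mem_Icc]; omega
    have t2 : Tendsto (fun n : ℕ => 2 * n) atTop atTop :=
      tendsto_atTop_mono (fun n => by simp only [id]; omega) tendsto_id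
    have tp : ∀ m : ℤ, Tendsto (fun n : ℕ => ((n : ℤ) + m).toNat) atTop atTop := fun m => by
      refine tendsto_atTop.2 fun b => ?_
      filter_upwards [eventually_ge_atTop (b + m.natAbs)] with n hn
      omega
    have t := (((hT.mul (hT.comp t2)).mul (hTi.comp (tp k))).mul (hTi.comp (tp (-k)))).mul_const
      (q ^ (k ^ 2).toNat)
    have e : qPochInf (q ^ 2) (q ^ 2) * qPochInf (q ^ 2) (q ^ 2) * (qPochInf (q ^ 2) (q ^ 2))⁻¹ *
        (qPochInf (q ^ 2) (q ^ 2))⁻¹ * q ^ (k ^ 2).toNat = q ^ (k ^ 2).toNat := by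
      field_simp
    rw [e] at t
    refine t.congr' ?_
    filter_upwards [ev] with n hn
    rw [fterm_eq q hP n k hn]
    simp only [Function.comp_apply, sub_eq_add_neg]
  · refine Eventually.of_forall fun n k => ?_
    by_cases hk : k ∈ Finset.Icc (-(n : ℤ)) n
    · rw [fterm_eq q hP n k hk]
      simp only [norm_mul, norm_pow]
      have h1 := hC n
      have h2 := hC (2 * n)
      have h3 := hD (n + k).toNat
      have h4 := hD (n - k).toNat
      gcongr
    · rw [fterm, if_neg hk, norm_zero]; positivity

lemma second_part (q : ℂ) (hq : ‖q‖ < 1) :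
    (∑' n : ℤ, q ^ (n ^ 2).toNat) = 1 + 2 * ∑' n : ℕ, q ^ ((n + 1) ^ 2) := by
  have hs : Summable fun n : ℤ => q ^ (n ^ 2).toNat := by
    refine Summable.of_norm ?_
    simpa only [norm_pow] using summable_sq_int _ (norm_nonneg q) hq
  rw [tsum_int_eq_zero_add_two_mul_tsum_pnat (fun n => by simp) hs]
  rw [tsum_pnat_eq_tsum_succ (f := fun n : ℕ => q ^ ((n : ℤ) ^ 2).toNat)]
  have e : ∀ n : ℕ, ((n : ℤ) ^ 2).toNat = n ^ 2 := fun n => by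
    rw [← Nat.cast_pow, Int.toNat_natCast]
  simp only [e]
  simp

theorem stmt_1 (q : ℂ) (hq : ‖q‖ < 1) :
    qPochInf (q ^ 2) (q ^ 2) * (qPochInf (-q) (q ^ 2)) ^ 2 = ∑' n : ℤ, q ^ (n ^ 2).toNat ∧
    (∑' n : ℤ, q ^ (n ^ 2).toNat) = 1 + 2 * ∑' n : ℕ, q ^ ((n + 1) ^ 2) := by
  refine ⟨?_, second_part q hq⟩
  by_cases hq0 : q = 0
  · rw [second_part q hq]
    subst hq0
    simp [qPochInf]
  · exact main_ne q hq hq0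
end

section
/- If n is a perfect square, then E_0(n) - E_1(n) = 2, where E_0(n) (resp. E_1(n)) counts two-color partitions of n into distinct parts, with even parts only in blue, having an even (resp. odd) number of even parts. -/
open scoped BigOperators

/-- Two-color partitions of `n` into distinct parts (a finset of blue parts and a
finset of green parts), where even parts occur only in blue (green parts are odd). -/
def IsEPartition (n : ℕ) (p : Finset ℕ × Finset ℕ) : Prop :=
  (∀ b ∈ p.1, 0 < b) ∧ (∀ g ∈ p.2, Odd g) ∧ p.1.sum id + p.2.sum id = n

open PowerSeries in
noncomputable def poc (N : ℕ) : PowerSeries ℤ :=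
  ∏ j ∈ Finset.range N, (1 - (X : PowerSeries ℤ) ^ (2 * (j + 1)))

open PowerSeries in
noncomputable def gB : ℕ → ℕ → PowerSeries ℤ
  | _, 0 => 1
  | 0, _ + 1 => 0
  | N + 1, k + 1 => gB N k + (X : PowerSeries ℤ) ^ (2 * (k + 1)) * gB N (k + 1)

open PowerSeries

theorem gB_zero (N : ℕ) : gB N 0 = 1 := by cases N <;> rfl

theorem gB_succ (N k : ℕ) :
    gB (N + 1) (k + 1) = gB N k + (X : PowerSeries ℤ) ^ (2 * (k + 1)) * gB N (k + 1) := rfl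

theorem gB_gt (N : ℕ) : ∀ k, N < k → gB N k = 0 := by
  induction N with
  | zero => intro k hk; cases k with
    | zero => omega
    | succ k => rfl
  | succ N ih => intro k hk; cases k with
    | zero => omega
    | succ k => rw [gB_succ, ih k (by omega), ih (k + 1) (by omega)]; simp

theorem gB_self (N : ℕ) : gB N N = 1 := by
  induction N with
  | zero => rfl
  | succ N ih => rw [gB_succ, ih, gB_gt N (N + 1) (by omega)]; simp

theorem poc_succ (N : ℕ) :
    poc (N + 1) = poc N * (1 - (X : PowerSeries ℤ) ^ (2 * (N + 1))) := by
  simp [poc, Finset.prod_range_succ]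

theorem gB_mul (N : ℕ) : ∀ a b, a + b = N → gB N a * poc a * poc b = poc N := by
  induction N with
  | zero =>
    intro a b h
    obtain ⟨rfl, rfl⟩ : a = 0 ∧ b = 0 := by omega
    simp [gB_zero, poc]
  | succ N ih =>
    intro a b h
    rcases a with _ | a
    · obtain rfl : b = N + 1 := by omega
      simp [gB_zero, poc]
    rcases b with _ | b
    · obtain rfl : a = N := by omega
      rw [gB_self]; simp [poc]
    have h1 := ih a (b + 1) (by omega)
    have h2 := ih (a + 1) b (by omega)
    have hN : N = a + b + 1 := by omega
    have e : (X : PowerSeries ℤ) ^ (2 * (N + 1)) = X ^ (2 * (a + 1)) * X ^ (2 * (b + 1)) := by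
      rw [← pow_add]; congr 1; omega
    rw [gB_succ, poc_succ N, e]
    rw [poc_succ b] at h1 ⊢
    rw [poc_succ a] at h2 ⊢
    linear_combination (1 - (X : PowerSeries ℤ) ^ (2 * (a + 1))) * h1
      + (X : PowerSeries ℤ) ^ (2 * (a + 1)) * (1 - X ^ (2 * (b + 1))) * h2

theorem poc_ccoeff (N : ℕ) : constantCoeff (poc N) = 1 := by
  simp [poc, map_prod]

theorem poc_ne (N : ℕ) : poc N ≠ 0 := by
  intro h
  have := poc_ccoeff N
  rw [h] at this
  simp at this

theorem gB_symm (a b : ℕ) : gB (a + b) a = gB (a + b) b := by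
  have h1 := gB_mul (a + b) a b rfl
  have h2 := gB_mul (a + b) b a (by omega)
  apply mul_right_cancel₀ (mul_ne_zero (poc_ne a) (poc_ne b))
  linear_combination h1 - h2

theorem gB_succ' (N k : ℕ) (h : k ≤ N) :
    gB (N + 1) (k + 1) = (X : PowerSeries ℤ) ^ (2 * (N - k)) * gB N k + gB N (k + 1) := by
  rcases h.eq_or_lt with rfl | h
  · rw [gB_self, gB_self, gB_gt k (k + 1) (by omega)]; simp
  obtain ⟨j, rfl⟩ : ∃ j, N = k + 1 + j := ⟨N - (k + 1), by omega⟩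
  have h1 : gB (k + 1 + j + 1) (k + 1) = gB (k + 1 + j + 1) (j + 1) := gB_symm (k + 1) (j + 1)
  have h2 : gB (k + 1 + j) (k + 1) = gB (k + 1 + j) j := gB_symm (k + 1) j
  have h3 : gB (k + 1 + j) k = gB (k + 1 + j) (j + 1) := by
    have := gB_symm k (j + 1)
    rwa [show k + (j + 1) = k + 1 + j by omega] at this
  rw [h1, gB_succ, h2, h3, show k + 1 + j - k = j + 1 by omega]
  ring

noncomputable def ex (k m : ℕ) : ℕ := ((k : ℤ) - m).natAbs ^ 2

theorem ex_cast (k m : ℕ) : (ex k m : ℤ) = ((k : ℤ) - m) ^ 2 := by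
  simp [ex]

noncomputable def hS (N m : ℕ) : PowerSeries ℤ :=
  ∑ k ∈ Finset.range (N + 1), (X : PowerSeries ℤ) ^ (ex k m) * gB N k

theorem sum_shift (N : ℕ) (f : ℕ → PowerSeries ℤ) :
    ∑ k ∈ Finset.range (N + 1), f (k + 1) * gB N (k + 1) + f 0
      = ∑ k ∈ Finset.range (N + 1), f k * gB N k := by
  have h := Finset.sum_range_succ' (fun k => f k * gB N k) (N + 1)
  rw [Finset.sum_range_succ, gB_gt N (N + 1) (by omega)] at h
  simpa [gB_zero] using h.symm

theorem hS_B (N m : ℕ) (h : m ≤ N) :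
    hS (N + 1) m = (1 + (X : PowerSeries ℤ) ^ (2 * (N - m) + 1)) * hS N m := by
  have h1 := sum_shift N (fun k => (X : PowerSeries ℤ) ^ (ex k m))
  unfold hS
  rw [Finset.sum_range_succ', add_mul, one_mul]
  nth_rewrite 1 [← h1]
  rw [Finset.mul_sum]
  simp only [gB_zero, mul_one]
  rw [add_right_comm, ← Finset.sum_add_distrib]
  congr 1
  apply Finset.sum_congr rfl
  intro k hk
  have hk : k ≤ N := by simp at hk; omega
  rw [gB_succ' N k hk]
  have e : (X : PowerSeries ℤ) ^ ex (k + 1) m * X ^ (2 * (N - k))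
      = X ^ (2 * (N - m) + 1) * X ^ ex k m := by
    rw [← pow_add, ← pow_add]; congr 1
    zify [h, hk]; rw [ex_cast, ex_cast]; push_cast; ring
  linear_combination gB N k * e

theorem hS_A (N m : ℕ) :
    hS (N + 1) (m + 1) = (1 + (X : PowerSeries ℤ) ^ (2 * m + 1)) * hS N m := by
  have h1 := sum_shift N (fun k => (X : PowerSeries ℤ) ^ (2 * m + 1 + ex k m))
  unfold hS
  rw [Finset.sum_range_succ', add_mul, one_mul, Finset.mul_sum]
  simp only [gB_zero, mul_one]
  simp_rw [← mul_assoc, ← pow_add]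
  rw [← h1, ← add_assoc, ← Finset.sum_add_distrib]
  congr 1
  · apply Finset.sum_congr rfl
    intro k hk
    rw [gB_succ]
    have e1 : ex (k + 1) (m + 1) = ex k m := by
      zify; rw [ex_cast, ex_cast]; push_cast; ring
    have e : (X : PowerSeries ℤ) ^ ex (k + 1) (m + 1) * X ^ (2 * (k + 1))
        = X ^ (2 * m + 1 + ex (k + 1) m) := by
      rw [← pow_add]; congr 1
      zify; rw [ex_cast, ex_cast]; push_cast; ring
    rw [mul_add, ← mul_assoc, e, e1]
  · congr 1
    zify; rw [ex_cast, ex_cast]; push_cast; ring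

theorem hS_prod (m : ℕ) :
    hS (2 * m) m = ∏ j ∈ Finset.range m, (1 + (X : PowerSeries ℤ) ^ (2 * j + 1)) ^ 2 := by
  induction m with
  | zero => simp [hS, gB_zero, ex]
  | succ m ih =>
    rw [Finset.prod_range_succ, ← ih, show 2 * (m + 1) = 2 * m + 1 + 1 by ring, hS_A,
      hS_B _ _ (by omega), show 2 * m - m = m by omega]
    ring

/-- `poc M` agrees with `poc a` modulo `X^(2(a+1))`. -/
theorem poc_mod (a M : ℕ) (h : a ≤ M) :
    (X : PowerSeries ℤ) ^ (2 * (a + 1)) ∣ poc M - poc a := by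
  induction M, h using Nat.le_induction with
  | base => simp
  | succ M hM ih =>
    have : poc (M + 1) - poc a = (poc M - poc a) - X ^ (2 * (M + 1)) * poc M := by
      rw [poc_succ]; ring
    rw [this]
    exact dvd_sub ih ((pow_dvd_pow _ (by omega)).mul_right _)

theorem poc_gB_aux (a b m : ℕ) (ha : a ≤ m) (hb : m ≤ b) :
    (X : PowerSeries ℤ) ^ (2 * (a + 1)) ∣ poc m * gB (a + b) a - 1 := by
  have h := gB_mul (a + b) a b rfl
  have h1 := poc_mod a m ha
  have h2 := poc_mod a (a + b) (by omega)
  have h3 := poc_mod a b (by omega)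
  have hu : IsUnit (poc a * poc b) := by
    rw [isUnit_iff_constantCoeff, map_mul, poc_ccoeff, poc_ccoeff]; simp
  rw [← hu.dvd_mul_right]
  have : (poc m * gB (a + b) a - 1) * (poc a * poc b)
      = poc m * (poc (a + b) - poc a) + poc a * (poc m - poc a) - poc a * (poc b - poc a) := by
    linear_combination poc m * h
  rw [this]
  exact dvd_sub (dvd_add (h2.mul_left _) (h1.mul_left _)) (h3.mul_left _)

theorem poc_gB (m k n : ℕ) (hk : k ≤ 2 * m) (hn : n ≤ 2 * m) :
    coeff n ((X : PowerSeries ℤ) ^ ex k m * (poc m * gB (2 * m) k)) = if n = ex k m then 1 else 0 := by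
  have key : (X : PowerSeries ℤ) ^ (n + 1) ∣ X ^ ex k m * (poc m * gB (2 * m) k - 1) := by
    obtain ⟨a, h, hd⟩ : ∃ a, (X : PowerSeries ℤ) ^ (2 * (a + 1)) ∣ poc m * gB (2 * m) k - 1 ∧
        n + 1 ≤ ex k m + 2 * (a + 1) := by
      rcases le_total k m with h | h
      · refine ⟨k, ?_, ?_⟩
        · have := poc_gB_aux k (2 * m - k) m h (by omega)
          rwa [show k + (2 * m - k) = 2 * m by omega] at this
        · zify at *; rw [ex_cast]; nlinarith [sq_nonneg ((k : ℤ) - m + 1)]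
      · refine ⟨2 * m - k, ?_, ?_⟩
        · have := poc_gB_aux (2 * m - k) k m (by omega) h
          rw [gB_symm] at this
          rwa [show 2 * m - k + k = 2 * m by omega] at this
        · zify [hk] at *; rw [ex_cast]; nlinarith [sq_nonneg ((k : ℤ) - m - 1)]
    refine (pow_dvd_pow _ hd).trans ?_
    rw [pow_add]
    exact mul_dvd_mul_left _ h
  have h0 := X_pow_dvd_iff.1 key n (by omega)
  rw [mul_sub, mul_one, map_sub, sub_eq_zero] at h0
  rw [h0, coeff_X_pow]

theorem coeff_main (r m : ℕ) (hr : 0 < r) (hm : r ≤ m) (hn : r ^ 2 ≤ 2 * m) :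
    coeff (r ^ 2) (poc m * ∏ j ∈ Finset.range m, (1 + (X : PowerSeries ℤ) ^ (2 * j + 1)) ^ 2) = 2 := by
  rw [← hS_prod, hS, Finset.mul_sum, map_sum]
  have : ∀ k ∈ Finset.range (2 * m + 1),
      coeff (r ^ 2) (poc m * ((X : PowerSeries ℤ) ^ ex k m * gB (2 * m) k))
        = if k ∈ ({m - r, m + r} : Finset ℕ) then 1 else 0 := by
    intro k hk
    rw [mul_left_comm, poc_gB m k _ (by simp at hk; omega) hn]
    congr 1
    simp only [ex, Finset.mem_insert, Finset.mem_singleton, eq_iff_iff]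
    rw [Nat.pow_left_inj (by norm_num)]
    omega
  rw [Finset.sum_congr rfl this, Finset.sum_ite_mem, Finset.inter_eq_right.2]
  · rw [Finset.sum_const, Finset.card_pair (by omega)]; simp
  · intro k; simp; omega

/-- Blue parts. -/
theorem blue_prod (m : ℕ) :
    ∏ i ∈ Finset.Icc 1 (2 * m), (1 + (if Even i then (-1 : PowerSeries ℤ) else 1) * X ^ i)
      = poc m * ∏ j ∈ Finset.range m, (1 + (X : PowerSeries ℤ) ^ (2 * j + 1)) := by
  induction m with
  | zero => simp [poc]
  | succ m ih =>
    rw [show 2 * (m + 1) = 2 * m + 1 + 1 by ring, Finset.prod_Icc_succ_top (by omega),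
      Finset.prod_Icc_succ_top (by omega), ih, poc_succ, Finset.prod_range_succ]
    have h1 : ¬ Even (2 * m + 1) := by simp
    have h2 : Even (2 * m + 1 + 1) := ⟨m + 1, by ring⟩
    rw [if_neg h1, if_pos h2]
    ring

theorem green_prod (m : ℕ) :
    ∏ i ∈ (Finset.Icc 1 (2 * m)).filter (fun i => Odd i), (1 + (X : PowerSeries ℤ) ^ i)
      = ∏ j ∈ Finset.range m, (1 + (X : PowerSeries ℤ) ^ (2 * j + 1)) := by
  rw [Finset.prod_filter]
  induction m with
  | zero => simp
  | succ m ih =>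
    rw [show 2 * (m + 1) = 2 * m + 1 + 1 by ring, Finset.prod_Icc_succ_top (by omega),
      Finset.prod_Icc_succ_top (by omega), ih, Finset.prod_range_succ]
    have h1 : Odd (2 * m + 1) := by simp
    have h2 : ¬ Odd (2 * m + 1 + 1) := by
      rw [Nat.not_odd_iff_even]; exact ⟨m + 1, by ring⟩
    rw [if_pos h1, if_neg h2]
    ring

def pairs (m : ℕ) : Finset (Finset ℕ × Finset ℕ) :=
  (Finset.Icc 1 (2 * m)).powerset ×ˢ ((Finset.Icc 1 (2 * m)).filter (fun i => Odd i)).powerset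

theorem expand_pairs (m : ℕ) :
    poc m * ∏ j ∈ Finset.range m, (1 + (X : PowerSeries ℤ) ^ (2 * j + 1)) ^ 2
      = ∑ p ∈ pairs m, (-1 : PowerSeries ℤ) ^ ((p.1.filter (fun x => Even x)).card)
          * X ^ (p.1.sum id + p.2.sum id) := by
  have : poc m * ∏ j ∈ Finset.range m, (1 + (X : PowerSeries ℤ) ^ (2 * j + 1)) ^ 2
      = (∏ i ∈ Finset.Icc 1 (2 * m), (1 + (if Even i then (-1 : PowerSeries ℤ) else 1) * X ^ i))
        * ∏ i ∈ (Finset.Icc 1 (2 * m)).filter (fun i => Odd i), (1 + (X : PowerSeries ℤ) ^ i) := by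
    rw [blue_prod, green_prod, Finset.prod_pow]; ring
  rw [this, Finset.prod_one_add, Finset.prod_one_add, Finset.sum_mul_sum, pairs,
    Finset.sum_product]
  refine Finset.sum_congr rfl fun b _ => Finset.sum_congr rfl fun g _ => ?_
  rw [Finset.prod_mul_distrib, ← Finset.prod_filter, Finset.prod_const, pow_add,
    Finset.prod_pow_eq_pow_sum, Finset.prod_pow_eq_pow_sum]
  simp only [id, mul_assoc]

theorem mem_pairs (n : ℕ) (p : Finset ℕ × Finset ℕ) :
    IsEPartition n p ↔ p ∈ (pairs n).filter (fun p => p.1.sum id + p.2.sum id = n) := by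
  simp only [IsEPartition, pairs, Finset.mem_filter, Finset.mem_product, Finset.mem_powerset,
    Finset.subset_iff, Finset.mem_Icc]
  constructor
  · rintro ⟨h1, h2, h3⟩
    refine ⟨⟨fun b hb => ⟨h1 b hb, ?_⟩, fun g hg => ⟨⟨(h2 g hg).pos, ?_⟩, h2 g hg⟩⟩, h3⟩
    · have := Finset.single_le_sum (f := id) (fun i _ => Nat.zero_le _) hb
      simp only [id] at *; omega
    · have := Finset.single_le_sum (f := id) (fun i _ => Nat.zero_le _) hg
      simp only [id] at *; omega
  · rintro ⟨⟨h1, h2⟩, h3⟩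
    exact ⟨fun b hb => (h1 hb).1, fun g hg => (h2 hg).2, h3⟩

theorem stmt_4 (n : ℕ) (hn : 0 < n) (hsq : ∃ k : ℕ, n = k ^ 2) :
    Nat.card {p : Finset ℕ × Finset ℕ //
        IsEPartition n p ∧ Even ((p.1.filter (fun x => Even x)).card)} =
    Nat.card {p : Finset ℕ × Finset ℕ //
        IsEPartition n p ∧ Odd ((p.1.filter (fun x => Even x)).card)} + 2 := by
  obtain ⟨r, hr⟩ := hsq
  have hr0 : 0 < r := by
    rcases r with _ | r
    · simp at hr; omega
    · omega
  have hc := coeff_main r n hr0 (by nlinarith) (by omega)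
  rw [← hr, expand_pairs, map_sum] at hc
  set S := (pairs n).filter (fun p => p.1.sum id + p.2.sum id = n) with hS
  have e (P : Finset ℕ × Finset ℕ → Prop) [DecidablePred P] :
      Nat.card {p : Finset ℕ × Finset ℕ // IsEPartition n p ∧ P p} = (S.filter P).card := by
    apply Nat.subtype_card
    intro p
    rw [Finset.mem_filter, mem_pairs]
  rw [e, e]
  have hc2 : ∑ p ∈ S, (-1 : ℤ) ^ ((p.1.filter (fun x => Even x)).card) = 2 := by
    rw [← hc, hS, Finset.sum_filter]
    refine Finset.sum_congr rfl fun p _ => ?_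
    have h1 : (-1 : PowerSeries ℤ) ^ ((p.1.filter (fun x => Even x)).card)
        = C ((-1 : ℤ) ^ ((p.1.filter (fun x => Even x)).card)) := by simp
    rw [h1, coeff_C_mul, coeff_X_pow, mul_ite, mul_one, mul_zero]
    simp only [eq_comm]
  rw [← Finset.sum_filter_add_sum_filter_not S
    (fun p => Even ((p.1.filter (fun x => Even x)).card))] at hc2
  rw [Finset.sum_congr rfl (g := fun _ => (1 : ℤ))
      (fun p hp => (Finset.mem_filter.1 hp).2.neg_one_pow),
    Finset.sum_congr (s₁ := S.filter (fun p => ¬ Even ((p.1.filter (fun x => Even x)).card)))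
      rfl (g := fun _ => (-1 : ℤ))
      (fun p hp => (Nat.not_even_iff_odd.1 (Finset.mem_filter.1 hp).2).neg_one_pow)] at hc2
  simp only [Finset.sum_const, Nat.not_even_iff_odd, nsmul_eq_mul] at hc2
  zify
  linarith
end

section
/- For |q|<1, ∑_{n≥0} q^{2n+1} (q^{2n+2};q^2)_∞ / (q^{2n+1};q^2)_∞^2 = q·ω(q), where ω(q) = ∑_{n≥0} q^{2n^2+2n}/(q;q^2)_{n+1}^2 is Ramanujan's third order mock theta function. -/
open scoped BigOperators

open Filter Topology

theorem aux_norm_lt {a Q : ℂ} (ha : ‖a‖ < 1) (hQ : ‖Q‖ < 1) (n : ℕ) : ‖a * Q ^ n‖ < 1 := by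
  rw [norm_mul, norm_pow]
  calc ‖a‖ * ‖Q‖ ^ n ≤ ‖a‖ * 1 := by
        gcongr
        exact pow_le_one₀ (norm_nonneg _) hQ.le
    _ < 1 := by simpa using ha

theorem aux_ne {a Q : ℂ} (ha : ‖a‖ < 1) (hQ : ‖Q‖ < 1) (n : ℕ) : 1 - a * Q ^ n ≠ 0 := by
  intro h
  have h1 := aux_norm_lt ha hQ n
  rw [← sub_eq_zero.mp h] at h1
  simp at h1

theorem aux_summable (a : ℂ) {Q : ℂ} (hQ : ‖Q‖ < 1) : Summable (fun n : ℕ => ‖-(a * Q ^ n)‖) := by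
  simp only [norm_neg, norm_mul, norm_pow]
  exact (summable_geometric_of_lt_one (norm_nonneg _) hQ).mul_left _

theorem aux_mult (a : ℂ) {Q : ℂ} (hQ : ‖Q‖ < 1) : Multipliable (fun n : ℕ => 1 - a * Q ^ n) := by
  simpa [sub_eq_add_neg] using multipliable_one_add_of_summable (aux_summable a hQ)

theorem inf_ne {a Q : ℂ} (ha : ‖a‖ < 1) (hQ : ‖Q‖ < 1) : qPochInf a Q ≠ 0 := by
  have := tprod_one_add_ne_zero_of_summable (f := fun n : ℕ => -(a * Q ^ n))
    (fun i => by simpa [sub_eq_add_neg] using aux_ne ha hQ i) (aux_summable a hQ)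
  simpa [qPochInf, sub_eq_add_neg] using this

theorem poch_tendsto (a : ℂ) {Q : ℂ} (hQ : ‖Q‖ < 1) :
    Tendsto (fun n => qPoch a Q n) atTop (𝓝 (qPochInf a Q)) :=
  (aux_mult a hQ).tendsto_prod_tprod_nat

theorem poch_succ (a Q : ℂ) (n : ℕ) : qPoch a Q (n + 1) = qPoch a Q n * (1 - a * Q ^ n) := by
  simp [qPoch, Finset.prod_range_succ]

theorem poch_ne {a Q : ℂ} (ha : ‖a‖ < 1) (hQ : ‖Q‖ < 1) (n : ℕ) : qPoch a Q n ≠ 0 :=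
  Finset.prod_ne_zero_iff.mpr fun j _ => aux_ne ha hQ j

theorem inf_rec (a : ℂ) {Q : ℂ} (hQ : ‖Q‖ < 1) (n : ℕ) :
    qPochInf (a * Q ^ n) Q = (1 - a * Q ^ n) * qPochInf (a * Q ^ (n + 1)) Q := by
  unfold qPochInf
  rw [tprod_eq_zero_mul' (f := fun j : ℕ => 1 - a * Q ^ n * Q ^ j)]
  · simp only [pow_zero, mul_one]
    congr 1
    apply tprod_congr
    intro b
    ring
  · have := aux_mult (a * Q ^ (n + 1)) hQ
    convert this using 2
    ring

theorem poch_mul_inf (a : ℂ) {Q : ℂ} (hQ : ‖Q‖ < 1) (n : ℕ) :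
    qPoch a Q n * qPochInf (a * Q ^ n) Q = qPochInf a Q := by
  induction n with
  | zero => simp [qPoch]
  | succ n ih => rw [← ih, poch_succ, inf_rec a hQ n]; ring

theorem inf_tendsto {a Q : ℂ} (ha : ‖a‖ < 1) (hQ : ‖Q‖ < 1) :
    Tendsto (fun n : ℕ => qPochInf (a * Q ^ n) Q) atTop (𝓝 1) := by
  have h : (fun n : ℕ => qPochInf (a * Q ^ n) Q) = fun n => qPochInf a Q / qPoch a Q n := by
    funext n
    rw [eq_div_iff (poch_ne ha hQ n), mul_comm, poch_mul_inf a hQ]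
  rw [h, ← div_self (inf_ne ha hQ)]
  exact tendsto_const_nhds.div (poch_tendsto a hQ) (inf_ne ha hQ)

theorem bdd_of_tendsto {u : ℕ → ℂ} {x : ℂ} (h : Tendsto u atTop (𝓝 x)) :
    ∃ M : ℝ, 0 ≤ M ∧ ∀ n, ‖u n‖ ≤ M := by
  obtain ⟨M, hM⟩ := (Metric.isBounded_range_of_tendsto u h).exists_norm_le
  have h0 : ∀ n, ‖u n‖ ≤ M := fun n => hM _ ⟨n, rfl⟩
  exact ⟨M, (norm_nonneg _).trans (h0 0), h0⟩

theorem tele {f T : ℕ → ℂ} {l : ℂ} (hf : Summable f) (h : ∀ n, f n = T (n + 1) - T n)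
    (hT : Tendsto T atTop (𝓝 l)) : ∑' n, f n = l - T 0 := by
  have h1 := hf.hasSum.tendsto_sum_nat
  have h2 : (fun n => ∑ i ∈ Finset.range n, f i) = fun n => T n - T 0 := by
    funext n
    simp only [h]
    exact Finset.sum_range_sub T n
  rw [h2] at h1
  exact tendsto_nhds_unique h1 (hT.sub_const _)

/-- general term of the left side -/
noncomputable def gT (c Q : ℂ) (k n : ℕ) : ℂ :=
  Q ^ n * qPochInf (Q * Q ^ n) Q / (qPochInf (c * Q ^ (n + k)) Q * qPochInf (c * Q ^ n) Q)

/-- general term of the right side -/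
noncomputable def rT (c Q : ℂ) (k n : ℕ) : ℂ :=
  (c * (c * Q ^ k)) ^ n * Q ^ (n ^ 2) * qPoch c Q k / (qPoch c Q (n + 1) * qPoch c Q (n + k + 1))

theorem gT_bound {c Q : ℂ} (hc : ‖c‖ < 1) (hQ : ‖Q‖ < 1) :
    ∃ M : ℝ, ∀ k n, ‖gT c Q k n‖ ≤ M * ‖Q‖ ^ n := by
  obtain ⟨M, hM, h1⟩ := bdd_of_tendsto (inf_tendsto hQ hQ)
  obtain ⟨N, hN, h2⟩ := bdd_of_tendsto ((inf_tendsto hc hQ).inv₀ one_ne_zero)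
  refine ⟨M * (N * N), fun k n => ?_⟩
  have : gT c Q k n = Q ^ n * (qPochInf (Q * Q ^ n) Q *
      ((qPochInf (c * Q ^ (n + k)) Q)⁻¹ * (qPochInf (c * Q ^ n) Q)⁻¹)) := by
    rw [gT, div_eq_mul_inv, mul_inv]; ring
  rw [this, norm_mul, norm_mul, norm_mul, norm_pow, mul_comm]
  gcongr
  · exact h1 n
  · exact h2 (n + k)
  · exact h2 n

theorem aux_pow_bound {c Q : ℂ} (hc : ‖c‖ < 1) (hQ : ‖Q‖ < 1) (k n : ℕ) :
    ‖(c * (c * Q ^ k)) ^ n * Q ^ (n ^ 2)‖ ≤ ‖c‖ ^ n := by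
  rw [norm_mul, norm_pow, norm_pow, norm_mul, mul_pow]
  have h1 : ‖c * Q ^ k‖ ^ n ≤ 1 := pow_le_one₀ (norm_nonneg _) (aux_norm_lt hc hQ k).le
  have h2 : ‖Q‖ ^ (n ^ 2) ≤ 1 := pow_le_one₀ (norm_nonneg _) hQ.le
  calc ‖c‖ ^ n * ‖c * Q ^ k‖ ^ n * ‖Q‖ ^ (n ^ 2) ≤ ‖c‖ ^ n * 1 * 1 := by gcongr
    _ = _ := by ring

theorem rT_bound {c Q : ℂ} (hc : ‖c‖ < 1) (hQ : ‖Q‖ < 1) :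
    ∃ M : ℝ, ∀ k n, ‖rT c Q k n‖ ≤ M * ‖c‖ ^ n := by
  obtain ⟨M, hM, h1⟩ := bdd_of_tendsto (poch_tendsto c hQ)
  obtain ⟨N, hN, h2⟩ := bdd_of_tendsto ((poch_tendsto c hQ).inv₀ (inf_ne hc hQ))
  refine ⟨M * (N * N), fun k n => ?_⟩
  have : rT c Q k n = ((c * (c * Q ^ k)) ^ n * Q ^ (n ^ 2)) * (qPoch c Q k *
      ((qPoch c Q (n + 1))⁻¹ * (qPoch c Q (n + k + 1))⁻¹)) := by
    rw [rT, div_eq_mul_inv, mul_inv]; ring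
  rw [this, norm_mul, norm_mul (qPoch c Q k), norm_mul (qPoch c Q (n+1))⁻¹, mul_comm]
  gcongr
  · exact h1 k
  · exact h2 (n + 1)
  · exact h2 (n + k + 1)
  · exact aux_pow_bound hc hQ k n

theorem sum_bound {f : ℕ → ℕ → ℂ} {r M : ℝ} (h0 : 0 ≤ r) (hr : r < 1)
    (h : ∀ k n, ‖f k n‖ ≤ M * r ^ n) :
    (∀ k, Summable (f k)) ∧ ∀ k, ‖∑' n, f k n‖ ≤ M * (1 - r)⁻¹ := by
  have hs := (hasSum_geometric_of_lt_one h0 hr).mul_left M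
  exact ⟨fun k => Summable.of_norm_bounded hs.summable (h k),
    fun k => tsum_of_norm_bounded hs (h k)⟩

theorem g_rec {c Q : ℂ} (hc : ‖c‖ < 1) (hQ : ‖Q‖ < 1) (hs : ∀ k, Summable (gT c Q k)) (k : ℕ) :
    (1 - c * Q ^ k) * ∑' n, gT c Q k n - c * ∑' n, gT c Q (k + 1) n = 1 := by
  have hP := inf_tendsto hc hQ
  have hne : ∀ n : ℕ, qPochInf (c * Q ^ n) Q ≠ 0 := fun n => inf_ne (aux_norm_lt hc hQ n) hQ
  rw [← tsum_mul_left, ← tsum_mul_left, ← ((hs k).mul_left _).tsum_sub ((hs (k+1)).mul_left _)]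
  rw [tele (T := fun n => (1 - Q ^ n) * qPochInf (Q * Q ^ n) Q /
    (qPochInf (c * Q ^ (n + k)) Q * qPochInf (c * Q ^ n) Q)) (l := 1)]
  · simp
  · exact ((hs k).mul_left _).sub ((hs (k+1)).mul_left _)
  · intro n
    have e1 := inf_rec Q hQ n
    have e2 := inf_rec c hQ n
    have e3 := inf_rec c hQ (n + k)
    have n1 := hne (n + 1)
    have n2 := hne (n + k + 1)
    have m1 := aux_ne hc hQ n
    have m2 := aux_ne hc hQ (n + k)
    simp only [gT]
    rw [show n + (k + 1) = n + k + 1 by ring, show n + 1 + k = n + k + 1 by ring, e1, e2, e3]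
    generalize qPochInf (c * Q ^ (n + 1)) Q = X at *
    generalize qPochInf (c * Q ^ (n + k + 1)) Q = Y at *
    generalize qPochInf (Q * Q ^ (n + 1)) Q = Z at *
    field_simp
    ring
  · have h1 : Tendsto (fun n : ℕ => Q ^ n) atTop (𝓝 0) := tendsto_pow_atTop_nhds_zero_of_norm_lt_one hQ
    have h2 := (((h1.const_sub 1).mul (inf_tendsto hQ hQ)).div
      (((tendsto_add_atTop_iff_nat k).mpr hP).mul hP) (by simp))
    simpa [Pi.div_def] using h2

theorem r_rec {c Q : ℂ} (hc : ‖c‖ < 1) (hQ : ‖Q‖ < 1) (hs : ∀ k, Summable (rT c Q k)) (k : ℕ) :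
    (1 - c * Q ^ k) * ∑' n, rT c Q k n - c * ∑' n, rT c Q (k + 1) n = 1 := by
  have hA := poch_tendsto c hQ
  have hA0 := inf_ne hc hQ
  have hne : ∀ n : ℕ, qPoch c Q n ≠ 0 := poch_ne hc hQ
  rw [← tsum_mul_left, ← tsum_mul_left, ← ((hs k).mul_left _).tsum_sub ((hs (k+1)).mul_left _)]
  rw [tele (T := fun n => -((c * (c * Q ^ k)) ^ n * Q ^ (n ^ 2) * qPoch c Q (k + 1) /
    (qPoch c Q n * qPoch c Q (n + k + 1)))) (l := 0)]
  · have := hne (k + 1)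
    have h0 : qPoch c Q 0 = 1 := by simp [qPoch]
    simp [h0, this]
  · exact ((hs k).mul_left _).sub ((hs (k+1)).mul_left _)
  · intro n
    have n1 := hne n
    have n2 := hne (n + k + 1)
    have m1 := aux_ne hc hQ n
    have m2 := aux_ne hc hQ (n + k + 1)
    simp only [rT]
    rw [show n + (k + 1) + 1 = n + k + 1 + 1 by ring, show n + 1 + k + 1 = n + k + 1 + 1 by ring,
      poch_succ c Q (n + k + 1), poch_succ c Q n, poch_succ c Q k]
    generalize qPoch c Q (n + k + 1) = X at *
    generalize qPoch c Q n = Y at *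
    generalize qPoch c Q k = Z at *
    field_simp
    ring
  · have h1 : Tendsto (fun n : ℕ => (c * (c * Q ^ k)) ^ n * Q ^ (n ^ 2)) atTop (𝓝 0) :=
      squeeze_zero_norm (aux_pow_bound hc hQ k) (tendsto_pow_atTop_nhds_zero_of_lt_one (norm_nonneg _) hc)
    have h2 := ((h1.mul_const (qPoch c Q (k + 1))).div
      (hA.mul ((tendsto_add_atTop_iff_nat (k + 1)).mpr hA)) (mul_ne_zero hA0 hA0)).neg
    simpa [add_assoc] using h2

theorem main_eq {c Q : ℂ} (hc : ‖c‖ < 1) (hQ : ‖Q‖ < 1) :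
    ∑' n, gT c Q 0 n = ∑' n, rT c Q 0 n := by
  obtain ⟨M, hM⟩ := gT_bound hc hQ
  obtain ⟨N, hN⟩ := rT_bound hc hQ
  obtain ⟨sg, bg⟩ := sum_bound (norm_nonneg _) hQ hM
  obtain ⟨sr, br⟩ := sum_bound (norm_nonneg _) hc hN
  set D : ℕ → ℂ := fun k => ∑' n, gT c Q k n - ∑' n, rT c Q k n with hD
  have hrec : ∀ k, (1 - c * Q ^ k) * D k = c * D (k + 1) := fun k => by
    have h1 := g_rec hc hQ sg k
    have h2 := r_rec hc hQ sr k
    simp only [hD]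
    linear_combination h1 - h2
  have hit : ∀ k, qPoch c Q k * D 0 = c ^ k * D k := fun k => by
    induction k with
    | zero => simp [qPoch]
    | succ k ih =>
      rw [poch_succ]
      linear_combination (1 - c * Q ^ k) * ih + c ^ k * hrec k
  have hb : ∀ k, ‖qPoch c Q k * D 0‖ ≤ ‖c‖ ^ k * (M * (1 - ‖Q‖)⁻¹ + N * (1 - ‖c‖)⁻¹) := fun k => by
    rw [hit, norm_mul, norm_pow]
    gcongr
    exact (norm_sub_le _ _).trans (add_le_add (bg k) (br k))
  have hz : Tendsto (fun k => qPoch c Q k * D 0) atTop (𝓝 0) := by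
    refine squeeze_zero_norm hb ?_
    simpa using (tendsto_pow_atTop_nhds_zero_of_lt_one (norm_nonneg _) hc).mul_const
      (M * (1 - ‖Q‖)⁻¹ + N * (1 - ‖c‖)⁻¹)
  have h0 := tendsto_nhds_unique hz ((poch_tendsto c hQ).mul_const (D 0))
  have h1 : D 0 = 0 := by
    rcases mul_eq_zero.mp h0.symm with h | h
    · exact absurd h (inf_ne hc hQ)
    · exact h
  exact sub_eq_zero.mp h1

theorem stmt_5 (q : ℂ) (hq : ‖q‖ < 1) :
    (∑' n : ℕ, q ^ (2 * n + 1) * qPochInf (q ^ (2 * n + 2)) (q ^ 2) /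
        (qPochInf (q ^ (2 * n + 1)) (q ^ 2)) ^ 2) =
      q * ∑' n : ℕ, q ^ (2 * n ^ 2 + 2 * n) / (qPoch q (q ^ 2) (n + 1)) ^ 2 := by
  have hQ : ‖q ^ 2‖ < 1 := by
    rw [norm_pow]
    exact pow_lt_one₀ (norm_nonneg _) hq two_ne_zero
  have h := main_eq hq hQ
  have h1 : ∀ n : ℕ, q ^ (2 * n + 1) * qPochInf (q ^ (2 * n + 2)) (q ^ 2) /
        (qPochInf (q ^ (2 * n + 1)) (q ^ 2)) ^ 2 = q * gT q (q ^ 2) 0 n := fun n => by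
    have e1 : q ^ (2 * n + 2) = q ^ 2 * (q ^ 2) ^ n := by ring
    have e2 : q ^ (2 * n + 1) = q * (q ^ 2) ^ n := by ring
    rw [gT, e1, e2, add_zero]
    ring
  have h2 : ∀ n : ℕ, q ^ (2 * n ^ 2 + 2 * n) / (qPoch q (q ^ 2) (n + 1)) ^ 2
      = rT q (q ^ 2) 0 n := fun n => by
    have h0 : qPoch q (q ^ 2) 0 = 1 := by simp [qPoch]
    have e1 : q ^ (2 * n ^ 2 + 2 * n) = (q * (q * (q ^ 2) ^ 0)) ^ n * (q ^ 2) ^ (n ^ 2) := by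
      rw [← pow_mul q 2 (n ^ 2), pow_zero, mul_one, ← pow_two, ← pow_mul, ← pow_add]
      congr 1
      ring
    rw [rT, h0, add_zero, e1, mul_one, pow_two (qPoch q (q ^ 2) (n + 1))]
  simp only [h1, h2, tsum_mul_left, h]
end
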